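/- arXiv:1308.6665 — 2 statements merged into one kernel-verified Lean document; each statement's English description precedes it below -/
import Mathlib

section
/- Askey's Jackson-integral form of Ramanujan's summation: let 0<q<1 and let α, β be real numbers with 0 < α and α + β < 1, and let ξ > 0 satisfy log_q ξ + β ∉ ℤ. Define I(ξ) := (1-q) ∑_{ν∈ℤ} (ξ q^ν)^α (q·ξq^ν)_∞ / (q^β·ξq^ν)_∞. Then I(ξ) = C · ξ^α θ(q^{α+β}ξ)/θ(q^{β}ξ), where C = (1-q)(q)_∞ (q^{1-β})_∞ / ( (q^α)_∞ (q^{1-α-β})_∞ ). -/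
/-- The infinite q-shifted factorial `(u)_∞ = ∏_{l=0}^∞ (1 - u q^l)`. -/
noncomputable def qPoch (q u : ℝ) : ℝ := ∏' l : ℕ, (1 - u * q ^ l)

/-- The theta function `θ(z) = (z)_∞ (q/z)_∞ (q)_∞`. -/
noncomputable def qTheta (q z : ℝ) : ℝ := qPoch q z * qPoch q (q / z) * qPoch q q

/-- The bilateral Jackson integral `I(ξ) = ∫_0^{ξ∞} z^α (qz)_∞/(q^β z)_∞ d_q z / z`. -/
noncomputable def ramanujanI (q α β ξ : ℝ) : ℝ :=
  (1 - q) * ∑' ν : ℤ, (ξ * q ^ ν) ^ α * qPoch q (q * (ξ * q ^ ν)) / qPoch q (q ^ β * (ξ * q ^ ν))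

open Filter Topology

section QPoch

variable {q : ℝ}

theorem summable_norm_neg_mul_pow (hq0 : 0 < q) (hq1 : q < 1) (u : ℝ) :
    Summable fun l : ℕ => ‖-(u * q ^ l)‖ := by
  simpa [abs_mul, abs_of_pos hq0] using
    (summable_geometric_of_lt_one hq0.le hq1).mul_left |u|

theorem multipliable_qPoch (hq0 : 0 < q) (hq1 : q < 1) (u : ℝ) :
    Multipliable fun l : ℕ => 1 - u * q ^ l := by
  simpa [sub_eq_add_neg] using
    multipliable_one_add_of_summable (summable_norm_neg_mul_pow hq0 hq1 u)

theorem tendsto_prod_qPoch (hq0 : 0 < q) (hq1 : q < 1) (u : ℝ) :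
    Tendsto (fun N : ℕ => ∏ l ∈ Finset.range N, (1 - u * q ^ l)) atTop (𝓝 (qPoch q u)) :=
  (multipliable_qPoch hq0 hq1 u).hasProd.tendsto_prod_nat

theorem qPoch_eq_mul (hq0 : 0 < q) (hq1 : q < 1) (u : ℝ) :
    qPoch q u = (1 - u) * qPoch q (u * q) := by
  have h : (fun l : ℕ => 1 - u * q ^ (l + 1)) = fun l : ℕ => 1 - u * q * q ^ l := by
    funext l
    ring
  unfold qPoch
  rw [tprod_eq_zero_mul' (by rw [h]; exact multipliable_qPoch hq0 hq1 (u * q)), h]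
  simp

theorem qPoch_ne_zero (hq0 : 0 < q) (hq1 : q < 1) {u : ℝ} (hu : ∀ l : ℕ, u * q ^ l ≠ 1) :
    qPoch q u ≠ 0 := by
  have := tprod_one_add_ne_zero_of_summable (f := fun l : ℕ => -(u * q ^ l))
    (fun l h => hu l (by linarith)) (summable_norm_neg_mul_pow hq0 hq1 u)
  simpa [qPoch, sub_eq_add_neg] using this

theorem qPoch_ne_zero_of_lt_one (hq0 : 0 < q) (hq1 : q < 1) {u : ℝ} (hu0 : 0 ≤ u) (hu1 : u < 1) :
    qPoch q u ≠ 0 :=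
  qPoch_ne_zero hq0 hq1 fun _ =>
    ((mul_le_of_le_one_right hu0 (pow_le_one₀ hq0.le hq1.le)).trans_lt hu1).ne

theorem qPoch_eq_zero {u : ℝ} {l : ℕ} (hu : u * q ^ l = 1) : qPoch q u = 0 :=
  tprod_of_exists_eq_zero ⟨l, by simp [hu]⟩

theorem abs_qPoch_le (hq0 : 0 < q) (hq1 : q < 1) {u v : ℝ} (h : |u| ≤ v) :
    |qPoch q u| ≤ qPoch q (-v) := by
  refine le_of_tendsto_of_tendsto' (tendsto_prod_qPoch hq0 hq1 u).abs
    (tendsto_prod_qPoch hq0 hq1 (-v)) fun N => ?_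
  rw [Finset.abs_prod]
  refine Finset.prod_le_prod (fun _ _ => abs_nonneg _) fun l _ => ?_
  have h1 : |u * q ^ l| ≤ v * q ^ l := by
    rw [abs_mul, abs_of_pos (pow_pos hq0 l)]
    gcongr
  have h2 := abs_sub 1 (u * q ^ l)
  rw [abs_one] at h2
  linarith

theorem qPoch_zero : qPoch q 0 = 1 := by simp [qPoch]

theorem tendsto_qPoch_zero (hq0 : 0 < q) (hq1 : q < 1) : Tendsto (qPoch q) (𝓝 0) (𝓝 1) := by
  have := tendsto_tprod_one_add_of_dominated_convergence (𝓕 := 𝓝 (0 : ℝ))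
    (f := fun (u : ℝ) (l : ℕ) => -(u * q ^ l)) (g := fun _ => 0) (bound := fun l => q ^ l)
    (summable_geometric_of_lt_one hq0.le hq1)
    (fun l => by
      have : Continuous fun u : ℝ => -(u * q ^ l) := by fun_prop
      simpa using this.tendsto 0)
    (by
      filter_upwards [Metric.ball_mem_nhds (0 : ℝ) one_pos] with u hu l
      rw [norm_neg, norm_mul, norm_pow, Real.norm_of_nonneg hq0.le]
      exact mul_le_of_le_one_left (pow_nonneg hq0.le l) (mem_ball_zero_iff.mp hu).le)
  simp only [add_zero, tprod_one, ← sub_eq_add_neg] at this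
  exact this

theorem tendsto_mul_pow_zero (hq0 : 0 < q) (hq1 : q < 1) (c : ℝ) :
    Tendsto (fun N : ℕ => c * q ^ N) atTop (𝓝 0) := by
  simpa using (tendsto_pow_atTop_nhds_zero_of_lt_one hq0.le hq1).const_mul c

/-- A first-order `q`-difference equation, solved by a quotient of `q`-shifted factorials. -/
theorem qPoch_mul_eq_of_qDifference (hq0 : 0 < q) (hq1 : q < 1) {F : ℝ → ℝ} {x c d L : ℝ}
    (hF : ∀ k : ℕ, (1 - c * q ^ k) * F (x * q ^ k) = (1 - d * q ^ k) * F (x * q ^ (k + 1)))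
    (hL : Tendsto (fun N : ℕ => F (x * q ^ N)) atTop (𝓝 L)) :
    qPoch q c * F x = qPoch q d * L := by
  have key (N : ℕ) : (∏ l ∈ Finset.range N, (1 - c * q ^ l)) * F x =
      (∏ l ∈ Finset.range N, (1 - d * q ^ l)) * F (x * q ^ N) := by
    induction N with
    | zero => simp
    | succ N ih =>
      rw [Finset.prod_range_succ, Finset.prod_range_succ]
      linear_combination (1 - c * q ^ N) * ih + (∏ l ∈ Finset.range N, (1 - d * q ^ l)) * hF N
  refine tendsto_nhds_unique ((tendsto_prod_qPoch hq0 hq1 c).mul_const (F x)) ?_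
  simp_rw [key]
  exact (tendsto_prod_qPoch hq0 hq1 d).mul hL

end QPoch

/-- The `n`-th term of the bilateral series `₁ψ₁`, normalised so that it makes sense for all `b`. -/
noncomputable def psiTerm (q a z b : ℝ) (n : ℤ) : ℝ :=
  qPoch q (b * q ^ n) / qPoch q (a * q ^ n) * z ^ n

section Psi

variable {q a z : ℝ}

theorem qPoch_zpow_ne_zero (hq0 : 0 < q) (hq1 : q < 1) (ha : ∀ n : ℤ, a * q ^ n ≠ 1) (n : ℤ) :
    qPoch q (a * q ^ n) ≠ 0 :=
  qPoch_ne_zero hq0 hq1 fun l => by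
    rw [mul_assoc, ← zpow_natCast, ← zpow_add₀ hq0.ne']
    exact ha _

theorem qPoch_zpow_eq_mul (hq0 : 0 < q) (hq1 : q < 1) (u : ℝ) (n : ℤ) :
    qPoch q (u * q ^ n) = (1 - u * q ^ n) * qPoch q (u * q ^ (n + 1)) := by
  rw [qPoch_eq_mul hq0 hq1, zpow_add_one₀ hq0.ne', mul_assoc u]

theorem psiTerm_succ (hq0 : 0 < q) (hq1 : q < 1) (hz : z ≠ 0) (ha : ∀ n : ℤ, a * q ^ n ≠ 1)
    (b : ℝ) (n : ℤ) :
    (1 - b * q ^ n) * psiTerm q a z b (n + 1) = z * (1 - a * q ^ n) * psiTerm q a z b n := by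
  have h1 := qPoch_zpow_ne_zero hq0 hq1 ha (n + 1)
  have h2 : 1 - a * q ^ n ≠ 0 := sub_ne_zero.mpr (ha n).symm
  unfold psiTerm
  rw [qPoch_zpow_eq_mul hq0 hq1 b n, qPoch_zpow_eq_mul hq0 hq1 a n, zpow_add_one₀ hz]
  generalize a * q ^ n = A at *
  field_simp

theorem psiTerm_contiguous (hq0 : 0 < q) (hq1 : q < 1) (hz : z ≠ 0) (ha : ∀ n : ℤ, a * q ^ n ≠ 1)
    (b : ℝ) (n : ℤ) :
    a * z * psiTerm q a z b n - b * psiTerm q a z b (n + 1) =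
      z * (a - b) * psiTerm q a z (b * q) n := by
  have h1 := qPoch_zpow_ne_zero hq0 hq1 ha (n + 1)
  have h2 : 1 - a * q ^ n ≠ 0 := sub_ne_zero.mpr (ha n).symm
  have h3 : b * q * q ^ n = b * q ^ (n + 1) := by
    rw [zpow_add_one₀ hq0.ne']
    ring
  unfold psiTerm
  rw [h3, qPoch_zpow_eq_mul hq0 hq1 b n, qPoch_zpow_eq_mul hq0 hq1 a n, zpow_add_one₀ hz]
  field_simp
  ring

theorem summable_of_tendsto_ratio {f r : ℕ → ℝ} {ρ : ℝ} (hρ : |ρ| < 1)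
    (hr : Tendsto r atTop (𝓝 ρ)) (hf : ∀ᶠ n in atTop, f (n + 1) = r n * f n) : Summable f := by
  obtain ⟨s, hs, hs1⟩ := exists_between hρ
  refine summable_of_ratio_norm_eventually_le hs1 ?_
  filter_upwards [hf, hr.abs.eventually_le_const hs] with n hn hrn
  rw [hn, norm_mul]
  exact mul_le_mul_of_nonneg_right hrn (norm_nonneg _)

theorem summable_psiTerm_nat (hq0 : 0 < q) (hq1 : q < 1) (hz0 : 0 < z) (hz1 : z < 1)
    (ha : ∀ n : ℤ, a * q ^ n ≠ 1) (b : ℝ) : Summable fun n : ℕ => psiTerm q a z b n := by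
  have hA (c : ℝ) : Tendsto (fun n : ℕ => 1 - c * q ^ n) atTop (𝓝 1) := by
    simpa using (tendsto_mul_pow_zero hq0 hq1 c).const_sub 1
  refine summable_of_tendsto_ratio (r := fun n => z * (1 - a * q ^ n) / (1 - b * q ^ n))
    (ρ := z) (by rwa [abs_of_pos hz0])
    (by simpa [Pi.div_def] using ((hA a).const_mul z).div (hA b) one_ne_zero) ?_
  filter_upwards [(hA b).eventually_ne one_ne_zero] with n hn
  have := psiTerm_succ hq0 hq1 hz0.ne' ha b n
  rw [zpow_natCast] at this
  push_cast
  rw [div_mul_eq_mul_div, eq_div_iff hn]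
  linarith

theorem summable_psiTerm (hq0 : 0 < q) (hq1 : q < 1) (hz0 : 0 < z) (hz1 : z < 1) (ha0 : 0 < a)
    (ha : ∀ n : ℤ, a * q ^ n ≠ 1) {b : ℝ} (hb : |b| < a * z) : Summable (psiTerm q a z b) := by
  refine Summable.of_nat_of_neg_add_one (summable_psiTerm_nat hq0 hq1 hz0 hz1 ha b) ?_
  have hA (c : ℝ) : Tendsto (fun m : ℕ => q ^ (m + 2) - c) atTop (𝓝 (-c)) := by
    simpa using (((tendsto_pow_atTop_nhds_zero_of_lt_one hq0.le hq1).comp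
      (tendsto_add_atTop_nat 2)).sub_const c)
  refine summable_of_tendsto_ratio
    (r := fun m => (q ^ (m + 2) - b) / (z * (q ^ (m + 2) - a))) (ρ := -b / (z * -a)) ?_
    ((hA b).div ((hA a).const_mul z) (mul_ne_zero hz0.ne' (neg_ne_zero.mpr ha0.ne')))
    (Eventually.of_forall fun m => ?_)
  · rw [mul_neg, neg_div_neg_eq, abs_div, abs_of_pos (mul_pos hz0 ha0), div_lt_one (by positivity)]
    linarith
  · have h := psiTerm_succ hq0 hq1 hz0.ne' ha b (-(m + 2 : ℕ))
    have hne := ha (-(m + 2 : ℕ))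
    have hq : q ^ (m + 2) ≠ 0 := pow_ne_zero _ hq0.ne'
    rw [show (-((m + 2 : ℕ) : ℤ) + 1) = -((m : ℤ) + 1) by push_cast; ring] at h
    rw [zpow_neg, zpow_natCast] at h hne
    have hne' : q ^ (m + 2) - a ≠ 0 := fun h0 => hne (by
      rw [← sub_eq_zero.mp h0, mul_inv_cancel₀ hq])
    rw [show (-(((m + 1 : ℕ) : ℤ) + 1)) = -((m + 2 : ℕ) : ℤ) by push_cast; ring,
      div_mul_eq_mul_div, eq_div_iff (mul_ne_zero hz0.ne' hne')]
    field_simp at h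
    linarith

theorem psiTerm_q_mul_pow_neg (hq0 : 0 < q) {k m : ℕ} (h : k ≤ m) :
    psiTerm q a z (q * q ^ k) (-(m + 1)) = 0 := by
  obtain ⟨j, rfl⟩ := Nat.exists_eq_add_of_le h
  unfold psiTerm
  rw [qPoch_eq_zero (l := j), zero_div, zero_mul]
  rw [← zpow_natCast, ← zpow_natCast, ← zpow_one_add₀ hq0.ne', ← zpow_add₀ hq0.ne',
    ← zpow_add₀ hq0.ne', ← zpow_zero q]
  congr 1
  push_cast
  ring

theorem summable_psiTerm_q_mul_pow (hq0 : 0 < q) (hq1 : q < 1) (hz0 : 0 < z) (hz1 : z < 1)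
    (ha : ∀ n : ℤ, a * q ^ n ≠ 1) (k : ℕ) : Summable (psiTerm q a z (q * q ^ k)) := by
  refine Summable.of_nat_of_neg_add_one (summable_psiTerm_nat hq0 hq1 hz0 hz1 ha _)
    (summable_of_ne_finset_zero (s := Finset.range k) fun m hm => ?_)
  exact psiTerm_q_mul_pow_neg hq0 (by simpa using hm)

theorem tsum_psiTerm_contiguous (hq0 : 0 < q) (hq1 : q < 1) (hz : z ≠ 0) (ha0 : a ≠ 0)
    (ha : ∀ n : ℤ, a * q ^ n ≠ 1) {b : ℝ} (hb : Summable (psiTerm q a z b)) :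
    (1 - b / (a * z)) * ∑' n, psiTerm q a z b n = (1 - b / a) * ∑' n, psiTerm q a z (b * q) n := by
  have hs : Summable fun n => psiTerm q a z b (n + 1) := (Equiv.addRight (1 : ℤ)).summable_iff.mpr hb
  have hshift : ∑' n, psiTerm q a z b (n + 1) = ∑' n, psiTerm q a z b n :=
    (Equiv.addRight (1 : ℤ)).tsum_eq (psiTerm q a z b)
  have h : ∑' n, (a * z * psiTerm q a z b n - b * psiTerm q a z b (n + 1)) =
      ∑' n, z * (a - b) * psiTerm q a z (b * q) n :=
    tsum_congr (psiTerm_contiguous hq0 hq1 hz ha b)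
  rw [(hb.mul_left _).tsum_sub (hs.mul_left _), tsum_mul_left, tsum_mul_left, tsum_mul_left,
    hshift] at h
  field_simp
  linarith

theorem tendsto_tsum_psiTerm (hq0 : 0 < q) (hq1 : q < 1) (hz0 : 0 < z) (hz1 : z < 1) (ha0 : 0 < a)
    (ha : ∀ n : ℤ, a * q ^ n ≠ 1) :
    Tendsto (fun b => ∑' n, psiTerm q a z b n) (𝓝 0) (𝓝 (∑' n, psiTerm q a z 0 n)) := by
  have hb0 : 0 < a * z / 2 := by positivity
  have hs : Summable (psiTerm q a z (-(a * z / 2))) :=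
    summable_psiTerm hq0 hq1 hz0 hz1 ha0 ha (by rw [abs_neg, abs_of_pos hb0]; linarith)
  refine tendsto_tsum_of_dominated_convergence hs.abs (fun n => ?_) ?_
  · have h : Tendsto (fun b : ℝ => qPoch q (b * q ^ n)) (𝓝 0) (𝓝 1) :=
      (tendsto_qPoch_zero hq0 hq1).comp (by
        have : Continuous fun b : ℝ => b * q ^ n := by fun_prop
        simpa using this.tendsto 0)
    simpa [psiTerm, qPoch_zero] using (h.div_const (qPoch q (a * q ^ n))).mul_const (z ^ n)
  · filter_upwards [Metric.ball_mem_nhds (0 : ℝ) hb0] with b hb n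
    have hb' : |b| < a * z / 2 := mem_ball_zero_iff.mp hb
    have hle : |qPoch q (b * q ^ n)| ≤ |qPoch q (-(a * z / 2) * q ^ n)| := by
      rw [neg_mul]
      refine (abs_qPoch_le hq0 hq1 ?_).trans (le_abs_self _)
      rw [abs_mul, abs_of_pos (zpow_pos hq0 n)]
      gcongr
    unfold psiTerm
    rw [Real.norm_eq_abs, abs_mul, abs_mul, abs_div, abs_div]
    gcongr

/-- The `q`-difference equation in `b`, iterated to `b = 0`. -/
theorem qPoch_mul_tsum_psiTerm (hq0 : 0 < q) (hq1 : q < 1) (hz0 : 0 < z) (hz1 : z < 1)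
    (ha0 : 0 < a) (ha : ∀ n : ℤ, a * q ^ n ≠ 1) {b : ℝ}
    (hb : ∀ k : ℕ, Summable (psiTerm q a z (b * q ^ k))) :
    qPoch q (b / (a * z)) * ∑' n, psiTerm q a z b n =
      qPoch q (b / a) * ∑' n, psiTerm q a z 0 n := by
  refine qPoch_mul_eq_of_qDifference (F := fun b => ∑' n, psiTerm q a z b n) hq0 hq1 (fun k => ?_)
    ((tendsto_tsum_psiTerm hq0 hq1 hz0 hz1 ha0 ha).comp (tendsto_mul_pow_zero hq0 hq1 b))
  have h := tsum_psiTerm_contiguous hq0 hq1 hz0.ne' ha0.ne' ha (hb k)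
  rw [mul_assoc b, ← pow_succ] at h
  rw [div_mul_eq_mul_div, div_mul_eq_mul_div]
  exact h

/-- The `q`-binomial theorem. -/
theorem tsum_qBinomial (hq0 : 0 < q) (hq1 : q < 1) (hz0 : 0 < z) (hz1 : z < 1)
    (ha : ∀ n : ℤ, a * q ^ n ≠ 1) :
    qPoch q z * ∑' n : ℕ, psiTerm q a z q n = qPoch q (a * z) * (qPoch q q / qPoch q a) := by
  set c : ℕ → ℝ := fun n => qPoch q (q * q ^ n) / qPoch q (a * q ^ n) with hc
  have hterm (w : ℝ) (n : ℕ) : psiTerm q a w q n = c n * w ^ n := by simp [psiTerm, hc]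
  have hsum {w : ℝ} (hw0 : 0 < w) (hw1 : w < 1) : Summable fun n : ℕ => c n * w ^ n := by
    simpa only [hterm] using summable_psiTerm_nat hq0 hq1 hw0 hw1 ha q
  have hrec (n : ℕ) : (1 - q ^ (n + 1)) * c (n + 1) = (1 - a * q ^ n) * c n := by
    have h := psiTerm_succ hq0 hq1 one_ne_zero ha q n
    rw [← Nat.cast_succ, hterm, hterm, zpow_natCast] at h
    simp only [one_pow, mul_one, one_mul] at h
    rw [pow_succ', h]
  have heq {w : ℝ} (hw0 : 0 < w) (hw1 : w < 1) :
      (1 - w) * ∑' n, c n * w ^ n = (1 - a * w) * ∑' n, c n * (w * q) ^ n := by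
    have hwq1 : w * q < 1 := mul_lt_one_of_nonneg_of_lt_one_left hw0.le hw1 hq1.le
    have h1 := hsum hw0 hw1
    have h2 := hsum (mul_pos hw0 hq0) hwq1
    have hdiff : ∑' n, (c n * w ^ n - c n * (w * q) ^ n) =
        ∑' n, w * (c n * w ^ n - a * (c n * (w * q) ^ n)) := by
      rw [(h1.sub h2).tsum_eq_zero_add]
      simp only [pow_zero, sub_self, zero_add]
      refine tsum_congr fun n => ?_
      rw [mul_pow, mul_pow]
      linear_combination w ^ (n + 1) * hrec n
    rw [h1.tsum_sub h2, tsum_mul_left, h1.tsum_sub (h2.mul_left a), tsum_mul_left] at hdiff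
    linarith
  have hpow (k : ℕ) : 0 < z * q ^ k ∧ z * q ^ k ≤ z :=
    ⟨by positivity, mul_le_of_le_one_right hz0.le (pow_le_one₀ hq0.le hq1.le)⟩
  simp only [hterm]
  refine qPoch_mul_eq_of_qDifference (F := fun w => ∑' n, c n * w ^ n) hq0 hq1 (fun k => ?_) ?_
  · have h := heq (hpow k).1 ((hpow k).2.trans_lt hz1)
    rw [mul_assoc z, ← pow_succ, ← mul_assoc a] at h
    exact h
  · have hlim : ∑' n, c n * (0 : ℝ) ^ n = qPoch q q / qPoch q a := by
      rw [tsum_eq_single 0 fun n hn => by simp [hn]]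
      simp [hc]
    rw [← hlim]
    refine tendsto_tsum_of_dominated_convergence (hsum hz0 hz1).abs (fun n => ?_)
      (Eventually.of_forall fun N n => ?_)
    · exact ((tendsto_mul_pow_zero hq0 hq1 z).pow n).const_mul (c n)
    · rw [Real.norm_eq_abs, abs_mul, abs_mul, abs_pow, abs_pow, abs_of_pos (hpow N).1,
        abs_of_pos hz0]
      have := (hpow N).1.le
      have := (hpow N).2
      gcongr

/-- Ramanujan's `₁ψ₁` summation. -/
theorem tsum_psiTerm (hq0 : 0 < q) (hq1 : q < 1) (hz0 : 0 < z) (hz1 : z < 1) (ha0 : 0 < a)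
    (ha : ∀ n : ℤ, a * q ^ n ≠ 1) {b : ℝ} (hb0 : 0 < b) (hb : b < a * z) :
    ∑' n, psiTerm q a z b n =
      qPoch q (a * z) * qPoch q (q / (a * z)) * qPoch q q * qPoch q (b / a) /
        (qPoch q z * qPoch q (b / (a * z)) * qPoch q a * qPoch q (q / a)) := by
  have hq_pos (k : ℕ) : 0 < q ^ k := pow_pos hq0 k
  have hFb := qPoch_mul_tsum_psiTerm hq0 hq1 hz0 hz1 ha0 ha (b := b) fun k =>
    summable_psiTerm hq0 hq1 hz0 hz1 ha0 ha (by
      rw [abs_of_pos (mul_pos hb0 (hq_pos k))]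
      exact (mul_le_of_le_one_right hb0.le (pow_le_one₀ hq0.le hq1.le)).trans_lt hb)
  have hFq := qPoch_mul_tsum_psiTerm hq0 hq1 hz0 hz1 ha0 ha (b := q)
    (summable_psiTerm_q_mul_pow hq0 hq1 hz0 hz1 ha)
  have hbin := tsum_qBinomial hq0 hq1 hz0 hz1 ha
  have hneg (m : ℕ) : psiTerm q a z q (-(m + 1)) = 0 := by
    simpa using psiTerm_q_mul_pow_neg (a := a) (z := z) hq0 m.zero_le
  have hsplit : ∑' n : ℤ, psiTerm q a z q n = ∑' n : ℕ, psiTerm q a z q n := by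
    rw [tsum_of_nat_of_neg_add_one (summable_psiTerm_nat hq0 hq1 hz0 hz1 ha q)
      (by simpa only [hneg] using summable_zero)]
    simp only [hneg, tsum_zero, add_zero]
  rw [← hsplit] at hbin
  have hPa : qPoch q a ≠ 0 := by simpa using qPoch_zpow_ne_zero hq0 hq1 ha 0
  have hPz : qPoch q z ≠ 0 := qPoch_ne_zero_of_lt_one hq0 hq1 hz0.le hz1
  have hPb : qPoch q (b / (a * z)) ≠ 0 :=
    qPoch_ne_zero_of_lt_one hq0 hq1 (by positivity) ((div_lt_one (by positivity)).mpr hb)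
  have hPq : qPoch q (q / a) ≠ 0 := by
    refine qPoch_ne_zero hq0 hq1 fun l h => ha (-(l + 1 : ℕ)) ?_
    rw [zpow_neg, zpow_natCast, pow_succ']
    have := hq_pos l
    field_simp at h ⊢
    exact h.symm
  generalize (∑' n, psiTerm q a z 0 n) = F0 at *
  generalize (∑' n, psiTerm q a z q n) = Fq at *
  rw [eq_div_iff (by positivity)]
  have hbin' : qPoch q z * Fq * qPoch q a = qPoch q (a * z) * qPoch q q := by
    rw [hbin]
    field_simp
  linear_combination qPoch q z * qPoch q a * qPoch q (q / a) * hFb -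
    qPoch q (b / a) * qPoch q z * qPoch q a * hFq +
    qPoch q (b / a) * qPoch q (q / (a * z)) * hbin'

end Psi

/-- Askey's Jackson-integral form of Ramanujan's summation. -/
theorem askey_jackson_integral_form (q α β ξ : ℝ) (hq0 : 0 < q) (hq1 : q < 1)
    (hα : 0 < α) (hαβ : α + β < 1) (hξ : 0 < ξ)
    (hgen : ∀ m : ℤ, Real.logb q ξ + β ≠ m) :
    ramanujanI q α β ξ =
      ((1 - q) * qPoch q q * qPoch q (q ^ (1 - β)) /
          (qPoch q (q ^ α) * qPoch q (q ^ (1 - α - β)))) *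
        (ξ ^ α * qTheta q (q ^ (α + β) * ξ) / qTheta q (q ^ β * ξ)) := by
  have hz0 : 0 < q ^ α := Real.rpow_pos_of_pos hq0 α
  have hB0 : 0 < q ^ β := Real.rpow_pos_of_pos hq0 β
  have hz1 : q ^ α < 1 := Real.rpow_lt_one hq0.le hq1 hα
  have hqab : q ^ (α + β) = q ^ β * q ^ α := by rw [Real.rpow_add hq0, mul_comm]
  have hq1b : q ^ (1 - β) = q / q ^ β := by rw [Real.rpow_sub hq0, Real.rpow_one]
  have hq1ab : q ^ (1 - α - β) = q / (q ^ β * q ^ α) := by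
    rw [sub_sub, Real.rpow_sub hq0, Real.rpow_one, hqab]
  have ha0 : 0 < q ^ β * ξ := mul_pos hB0 hξ
  have ha : ∀ n : ℤ, q ^ β * ξ * q ^ n ≠ 1 := by
    intro n h
    apply hgen (-n)
    have hlog := congrArg (Real.logb q) h
    rw [Real.logb_mul ha0.ne' (zpow_pos hq0 n).ne', Real.logb_mul hB0.ne' hξ.ne',
      Real.logb_rpow hq0 hq1.ne, Real.logb_one, ← Real.rpow_intCast,
      Real.logb_rpow hq0 hq1.ne] at hlog
    push_cast
    linarith
  have hb : q * ξ < q ^ β * ξ * q ^ α := by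
    have h : q < q ^ (α + β) := by
      simpa using Real.rpow_lt_rpow_of_exponent_gt hq0 hq1 hαβ
    rw [hqab] at h
    nlinarith
  have hterm (n : ℤ) : (ξ * q ^ n) ^ α * qPoch q (q * (ξ * q ^ n)) / qPoch q (q ^ β * (ξ * q ^ n)) =
      ξ ^ α * psiTerm q (q ^ β * ξ) (q ^ α) (q * ξ) n := by
    have hpow : (q ^ n) ^ α = (q ^ α) ^ n := by
      rw [← Real.rpow_intCast, ← Real.rpow_intCast, ← Real.rpow_mul hq0.le, ← Real.rpow_mul hq0.le,
        mul_comm]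
    rw [psiTerm, Real.mul_rpow hξ.le (zpow_pos hq0 n).le, hpow, mul_assoc q, mul_assoc (q ^ β)]
    ring
  have hqq : qPoch q q ≠ 0 := qPoch_ne_zero_of_lt_one hq0 hq1 hq0.le hq1
  have e1 : q * ξ / (q ^ β * ξ) = q / q ^ β := by field_simp
  have e2 : q * ξ / (q ^ β * ξ * q ^ α) = q / (q ^ β * q ^ α) := by field_simp
  unfold ramanujanI qTheta
  simp_rw [hterm]
  rw [tsum_mul_left, tsum_psiTerm hq0 hq1 hz0 hz1 ha0 ha (mul_pos hq0 hξ) hb, hqab, hq1b, hq1ab,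
    e1, e2, mul_right_comm (q ^ β) (q ^ α) ξ]
  rw [← mul_assoc (ξ ^ α), mul_div_mul_right _ _ hqq]
  ring
end

section
/- Uniqueness of the theta solution of the first-order q-difference equation: let 0<q<1 and let c be a nonzero complex number. If f is holomorphic on ℂ∖{0} and satisfies f(qξ) = -f(ξ)/(c ξ) for all ξ ≠ 0, then there exists a constant C ∈ ℂ such that f(ξ) = C·θ(cξ) for all ξ ≠ 0. -/
/-- The infinite q-shifted factorial `(u)_∞ = ∏_{l=0}^∞ (1 - u q^l)`. -/
noncomputable def qPochC (q u : ℂ) : ℂ := ∏' l : ℕ, (1 - u * q ^ l)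

/-- The theta function `θ(z) = (z)_∞ (q/z)_∞ (q)_∞`. -/
noncomputable def qThetaC (q z : ℂ) : ℂ := qPochC q z * qPochC q (q / z) * qPochC q q

open Complex Set

theorem summable_norm_mul_geometric {q : ℂ} (hq : ‖q‖ < 1) (u : ℂ) :
    Summable fun l : ℕ ↦ ‖-(u * q ^ l)‖ := by
  simpa using (summable_geometric_of_lt_one (norm_nonneg q) hq).mul_left ‖u‖

theorem qPochC_eq_mul {q : ℂ} (hq : ‖q‖ < 1) (u : ℂ) :
    qPochC q u = (1 - u) * qPochC q (q * u) := by
  have key (l : ℕ) : 1 - u * q ^ (l + 1) = 1 - q * u * q ^ l := by ring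
  have h : Multipliable fun l : ℕ ↦ 1 - q * u * q ^ l := by
    simp_rw [sub_eq_add_neg]
    exact multipliable_one_add_of_summable (summable_norm_mul_geometric hq (q * u))
  have h' := tprod_eq_zero_mul' (f := fun l : ℕ ↦ 1 - u * q ^ l) (h.congr fun l ↦ (key l).symm)
  rw [tprod_congr key, pow_zero, mul_one] at h'
  exact h'

theorem qPochC_ne_zero {q : ℂ} (hq : ‖q‖ < 1) {u : ℂ} (hu : ∀ l : ℕ, u * q ^ l ≠ 1) :
    qPochC q u ≠ 0 := by
  simp only [qPochC, sub_eq_add_neg]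
  refine tprod_one_add_ne_zero_of_summable (fun l h ↦ hu l ?_) (summable_norm_mul_geometric hq u)
  linear_combination -h

theorem differentiable_qPochC {q : ℂ} (hq : ‖q‖ < 1) : Differentiable ℂ (qPochC q) := by
  rw [← differentiableOn_univ]
  have h : HasProdLocallyUniformlyOn (fun (l : ℕ) (u : ℂ) ↦ 1 - u * q ^ l)
      (fun u ↦ ∏' l : ℕ, (1 - u * q ^ l)) univ := by
    simp_rw [sub_eq_add_neg]
    refine hasProdLocallyUniformlyOn_of_forall_compact isOpen_univ fun K _ hK ↦ ?_
    obtain ⟨M, hM⟩ := hK.isBounded.exists_norm_le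
    refine ((summable_geometric_of_lt_one (norm_nonneg q) hq).mul_left
      M).hasProdUniformlyOn_nat_one_add hK (.of_forall fun l u hu ↦ ?_) (fun _ ↦ by fun_prop)
    simpa using mul_le_mul_of_nonneg_right (hM u hu) (by positivity)
  exact h.differentiableOn (.of_forall fun _ ↦ by
    simpa [Finset.prod_fn] using DifferentiableOn.finsetProd (fun _ _ ↦ by fun_prop)) isOpen_univ

theorem qThetaC_mul_left {q : ℂ} (hq0 : q ≠ 0) (hq : ‖q‖ < 1) {z : ℂ} (hz : z ≠ 0) :
    qThetaC q (q * z) = -qThetaC q z / z := by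
  have h1 := qPochC_eq_mul hq z
  have h2 := qPochC_eq_mul hq (1 / z)
  have e1 : q / (q * z) = 1 / z := by field_simp
  have e2 : q * (1 / z) = q / z := by ring
  rw [e2] at h2
  simp only [qThetaC]
  rw [e1, h2, h1]
  field_simp
  ring

theorem differentiableOn_qThetaC {q : ℂ} (hq : ‖q‖ < 1) :
    DifferentiableOn ℂ (qThetaC q) {(0 : ℂ)}ᶜ := by
  have h := differentiable_qPochC hq
  refine (h.differentiableOn.mul (h.comp_differentiableOn (f := fun z ↦ q / z) ?_)).mul_const _
  exact (differentiableOn_const q).div differentiableOn_id fun z hz ↦ hz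

theorem qThetaC_neg_one_ne_zero {q : ℝ} (hq0 : 0 < q) (hq1 : q < 1) :
    qThetaC (q : ℂ) (-1) ≠ 0 := by
  have hq : ‖(q : ℂ)‖ < 1 := by simpa [abs_of_pos hq0] using hq1
  have key (u : ℝ) (hu : u < 1) : qPochC (q : ℂ) (u : ℂ) ≠ 0 := by
    refine qPochC_ne_zero hq fun l h ↦ ?_
    have h' : u * q ^ l = 1 := by exact_mod_cast h
    have h0 : 0 < q ^ l := by positivity
    have h1 : q ^ l ≤ 1 := pow_le_one₀ hq0.le hq1.le
    nlinarith
  have h1 := key (-1) (by norm_num)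
  have h2 := key (q / -1) (by rw [div_neg, div_one]; linarith)
  push_cast at h1 h2
  exact mul_ne_zero (mul_ne_zero h1 h2) (key q hq1)

/-- A continuous function on a circle is zero if all its Fourier coefficients, written as circle
integrals, are zero. -/
theorem eqOn_zero_of_circleIntegral_zpow_eq_zero {F : ℂ → ℂ} {r : ℝ} (hr : 0 < r)
    (hF : ContinuousOn F (Metric.sphere 0 r))
    (h : ∀ n : ℤ, (∮ z in C(0, r), z⁻¹ * (z ^ (-n) * F z)) = 0) :
    EqOn F 0 (Metric.sphere 0 r) := by
  have : Fact (0 < 2 * Real.pi) := ⟨Real.two_pi_pos⟩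
  have hmem (x : AddCircle (2 * Real.pi)) : (r : ℂ) * x.toCircle ∈ Metric.sphere (0 : ℂ) r := by
    rw [mem_sphere_zero_iff_norm, norm_mul, Circle.norm_coe, mul_one, Complex.norm_of_nonneg hr.le]
  let g : C(AddCircle (2 * Real.pi), ℂ) :=
    ⟨fun x ↦ F (r * x.toCircle), hF.comp_continuous
      (continuous_const.mul (continuous_subtype_val.comp AddCircle.continuous_toCircle)) hmem⟩
  have hcoe (x : ℝ) : (r : ℂ) * (AddCircle.toCircle (x : AddCircle (2 * Real.pi))) =
      circleMap 0 r x := by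
    rw [AddCircle.toCircle_apply_mk, div_self Real.two_pi_pos.ne', one_mul]
    simp [circleMap]
  have hcoeff (n : ℤ) : fourierCoeff g n = 0 := by
    rw [fourierCoeff_eq_intervalIntegral g n 0, zero_add]
    have hint (x : ℝ) : fourier (-n) (x : AddCircle (2 * Real.pi)) • g x = ((r : ℂ) ^ n / I) *
        (deriv (circleMap 0 r) x • ((circleMap 0 r x)⁻¹ *
          (circleMap 0 r x ^ (-n) * F (circleMap 0 r x)))) := by
      have hr' : (r : ℂ) ≠ 0 := by exact_mod_cast hr.ne'
      have hg : g x = F (circleMap 0 r x) := congrArg F (hcoe x)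
      have ht : (AddCircle.toCircle (x : AddCircle (2 * Real.pi)) : ℂ) ≠ 0 := Circle.coe_ne_zero _
      rw [hg, deriv_circleMap, ← hcoe, fourier_apply, AddCircle.toCircle_zsmul, Circle.coe_zpow,
        smul_eq_mul, smul_eq_mul, mul_zpow]
      simp only [zpow_neg]
      field_simp
    simp_rw [hint]
    rw [intervalIntegral.integral_const_mul]
    have := h n
    rw [circleIntegral] at this
    rw [this]
    simp
  intro z hz
  have hz' : ‖z‖ = r := by simpa using hz
  have hs := has_pointwise_sum_fourier_series_of_summable (f := g)
    (by simp [funext hcoeff]) ((arg z : ℝ) : AddCircle (2 * Real.pi))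
  simp only [hcoeff, zero_smul] at hs
  have hgz : g ((arg z : ℝ) : AddCircle (2 * Real.pi)) = F z := by
    refine congrArg F ((hcoe _).trans ?_)
    rw [circleMap, zero_add, ← hz', norm_mul_exp_arg_mul_I]
  rw [← hgz]
  exact hs.unique hasSum_zero

theorem circleIntegral_zpow_mul_eq_of_differentiableOn {F : ℂ → ℂ}
    (hF : DifferentiableOn ℂ F {(0 : ℂ)}ᶜ) (n : ℤ) {r R : ℝ} (hr : 0 < r) (hR : r ≤ R) :
    (∮ z in C(0, R), z⁻¹ * (z ^ n * F z)) = ∮ z in C(0, r), z⁻¹ * (z ^ n * F z) := by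
  have hd : DifferentiableOn ℂ (fun z ↦ z ^ n * F z) {(0 : ℂ)}ᶜ := fun z hz ↦
    ((differentiableAt_zpow.2 (.inl hz)).differentiableWithinAt).mul (hF z hz)
  have := circleIntegral_sub_center_inv_smul_eq_of_differentiable_on_annulus_off_countable
    (c := 0) hr hR (f := fun z ↦ z ^ n * F z) countable_empty
    (hd.continuousOn.mono fun z hz h0 ↦ hz.2 (by
      rw [mem_singleton_iff.1 h0]; exact Metric.mem_ball_self hr))
    (fun z hz ↦ hd.differentiableAt (isOpen_compl_singleton.mem_nhds fun h0 ↦ hz.1.2 (by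
      rw [mem_singleton_iff.1 h0]; exact Metric.mem_closedBall_self hr.le)))
  simpa using this

theorem circleIntegral_inv_mul_comp_mul (G : ℂ → ℂ) {q r : ℝ} (hq : q ≠ 0) :
    (∮ z in C(0, q * r), z⁻¹ * G z) = ∮ z in C(0, r), z⁻¹ * G (q * z) := by
  simp only [circleIntegral, deriv_circleMap]
  refine intervalIntegral.integral_congr fun x _ ↦ ?_
  have hq' : (q : ℂ) ≠ 0 := by exact_mod_cast hq
  have e : circleMap 0 (q * r) x = q * circleMap 0 r x := by simp [circleMap, mul_assoc]
  simp only [e, smul_eq_mul]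
  field_simp

/-- A solution of the first-order theta `q`-difference equation on `ℂ ∖ {0}` with vanishing
constant Laurent coefficient is zero. -/
theorem eq_zero_of_q_difference {q : ℝ} (hq0 : 0 < q) (hq1 : q < 1) {c : ℂ} (hc : c ≠ 0)
    {F : ℂ → ℂ} (hF : DifferentiableOn ℂ F {(0 : ℂ)}ᶜ)
    (hFq : ∀ ξ : ℂ, ξ ≠ 0 → F ((q : ℂ) * ξ) = -F ξ / (c * ξ))
    (h0 : (∮ z in C(0, 1), z⁻¹ * F z) = 0) {ξ : ℂ} (hξ : ξ ≠ 0) : F ξ = 0 := by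
  have hq' : (q : ℂ) ≠ 0 := by exact_mod_cast hq0.ne'
  let a (n : ℤ) : ℂ := ∮ z in C(0, 1), z⁻¹ * (z ^ n * F z)
  have hrec (n : ℤ) : a n = (-(q : ℂ) ^ n / c) * a (n - 1) := by
    have h1 : a n = ∮ z in C(0, q * 1), z⁻¹ * (z ^ n * F z) :=
      circleIntegral_zpow_mul_eq_of_differentiableOn hF n (by simpa using hq0) (by simpa using hq1.le)
    rw [h1, circleIntegral_inv_mul_comp_mul (fun z ↦ z ^ n * F z) hq0.ne',
      ← circleIntegral.integral_const_mul]
    refine circleIntegral.integral_congr zero_le_one fun z hz ↦ ?_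
    have hz0 : z ≠ 0 := by
      rintro rfl
      simp at hz
    simp only [hFq z hz0, mul_zpow, zpow_sub_one₀ hz0]
    field_simp
  have ha (n : ℤ) : a n = 0 := by
    induction n using Int.induction_on with
    | zero => simpa [a] using h0
    | succ k ih => rw [hrec, add_sub_cancel_right, ih, mul_zero]
    | pred k ih =>
      rw [hrec] at ih
      refine (mul_eq_zero.1 ih).resolve_left ?_
      exact div_ne_zero (neg_ne_zero.2 (zpow_ne_zero _ hq')) hc
  have hpos : 0 < ‖ξ‖ := norm_pos_iff.2 hξ
  refine eqOn_zero_of_circleIntegral_zpow_eq_zero hpos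
    (hF.continuousOn.mono fun z hz h ↦ ?_) (fun n ↦ ?_) (x := ξ) (by simp)
  · rw [mem_singleton_iff.1 h] at hz
    simp [eq_comm, hξ] at hz
  · rcases le_total ‖ξ‖ 1 with h | h
    · exact (circleIntegral_zpow_mul_eq_of_differentiableOn hF (-n) hpos h).symm.trans (ha (-n))
    · exact (circleIntegral_zpow_mul_eq_of_differentiableOn hF (-n) one_pos h).trans (ha (-n))

/-- Uniqueness of the theta solution of the first-order q-difference equation
`f(qξ) = -f(ξ)/(cξ)` among functions holomorphic on `ℂ ∖ {0}`. -/
theorem theta_q_difference_uniqueness (q : ℝ) (hq0 : 0 < q) (hq1 : q < 1)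
    (c : ℂ) (hc : c ≠ 0) (f : ℂ → ℂ)
    (hf : DifferentiableOn ℂ f {(0 : ℂ)}ᶜ)
    (hfq : ∀ ξ : ℂ, ξ ≠ 0 → f ((q : ℂ) * ξ) = -f ξ / (c * ξ)) :
    ∃ C : ℂ, ∀ ξ : ℂ, ξ ≠ 0 → f ξ = C * qThetaC (q : ℂ) (c * ξ) := by
  have hq : ‖(q : ℂ)‖ < 1 := by simpa [abs_of_pos hq0] using hq1
  have hq' : (q : ℂ) ≠ 0 := by exact_mod_cast hq0.ne'
  let Θ (ξ : ℂ) : ℂ := qThetaC (q : ℂ) (c * ξ)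
  have hΘ : DifferentiableOn ℂ Θ {(0 : ℂ)}ᶜ :=
    (differentiableOn_qThetaC hq).comp (by fun_prop) fun ξ hξ ↦ mul_ne_zero hc hξ
  have hΘq (ξ : ℂ) (hξ : ξ ≠ 0) : Θ ((q : ℂ) * ξ) = -Θ ξ / (c * ξ) := by
    simp only [Θ]
    rw [mul_left_comm, qThetaC_mul_left hq' hq (mul_ne_zero hc hξ)]
  have hint {F : ℂ → ℂ} (hF : DifferentiableOn ℂ F {(0 : ℂ)}ᶜ) :
      CircleIntegrable (fun z ↦ z⁻¹ * F z) 0 1 := by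
    have hs : Metric.sphere (0 : ℂ) 1 ⊆ {0}ᶜ := fun z hz h ↦ by
      rw [mem_singleton_iff.1 h] at hz
      simp at hz
    exact ((continuousOn_inv₀.mono hs).mul (hF.continuousOn.mono hs)).circleIntegrable zero_le_one
  set A := ∮ z in C(0, 1), z⁻¹ * Θ z with hA
  have hA0 : A ≠ 0 := fun h ↦ by
    have := eq_zero_of_q_difference hq0 hq1 hc hΘ hΘq h (ξ := -1 / c) (by simp [hc])
    refine qThetaC_neg_one_ne_zero hq0 hq1 ?_
    simpa [Θ, mul_div_cancel₀ _ hc] using this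
  refine ⟨(∮ z in C(0, 1), z⁻¹ * f z) / A, fun ξ hξ ↦ ?_⟩
  set C := (∮ z in C(0, 1), z⁻¹ * f z) / A with hC
  have hd : DifferentiableOn ℂ (fun ξ ↦ C * Θ ξ) {(0 : ℂ)}ᶜ := hΘ.const_mul C
  refine sub_eq_zero.1 (eq_zero_of_q_difference (F := fun ξ ↦ f ξ - C * Θ ξ) hq0 hq1 hc
    (hf.sub hd) (fun ξ hξ ↦ ?_) ?_ hξ)
  · simp only [hfq ξ hξ, hΘq ξ hξ]
    ring
  · simp only [mul_sub]
    rw [circleIntegral.integral_sub (hint hf) (hint hd)]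
    simp only [mul_left_comm _ C]
    rw [circleIntegral.integral_const_mul, ← hA, hC, div_mul_cancel₀ _ hA0, sub_self]
end
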